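/- arXiv:2212.04099 — 2 statements merged into one kernel-verified Lean document; each statement's English description precedes it below -/
import Mathlib

section
/- Let k ≥ 6 and λ_k = k(k+3). Define F̃_k'(x) = (24/(λ_k(λ_k+2))) C_{k-1}^{5/2}(x), where C_{k-1}^{5/2} is the Gegenbauer polynomial of degree k-1 and parameter 5/2. Then F̃_k'(x) ≥ -0.081 for all x ∈ [0,1]. -/
/-- The Gegenbauer (ultraspherical) polynomial `C_n^ν` as a function on `ℝ`,
defined by the standard three-term recurrence
`(n+2) C_{n+2}(x) = 2(n+1+ν) x C_{n+1}(x) - (n+2ν) C_n(x)`. -/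
noncomputable def gegenbauer (ν : ℝ) : ℕ → ℝ → ℝ
  | 0 => fun _ => 1
  | 1 => fun x => 2 * ν * x
  | (n + 2) => fun x =>
      (2 * ((n:ℝ) + 1 + ν) * x * gegenbauer ν (n + 1) x
        - ((n:ℝ) + 2 * ν) * gegenbauer ν n x) / ((n:ℝ) + 2)

open Polynomial

/-- The Gegenbauer polynomial `C_n^ν` as an element of `ℝ[X]`. -/
noncomputable def gegenbauerPoly (ν : ℝ) : ℕ → ℝ[X]
  | 0 => 1
  | 1 => C (2 * ν) * X
  | (n + 2) => C (1 / ((n : ℝ) + 2)) *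
      (C (2 * ((n : ℝ) + 1 + ν)) * X * gegenbauerPoly ν (n + 1)
        - C ((n : ℝ) + 2 * ν) * gegenbauerPoly ν n)

theorem eval_gegenbauerPoly (ν : ℝ) (n : ℕ) (x : ℝ) :
    (gegenbauerPoly ν n).eval x = gegenbauer ν n x := by
  induction n using Nat.twoStepInduction with
  | zero => simp [gegenbauerPoly, gegenbauer]
  | one => simp [gegenbauerPoly, gegenbauer]
  | more n h0 h1 =>
    simp only [gegenbauerPoly, gegenbauer, eval_mul, eval_sub, eval_C, eval_X, h0, h1]
    ring

theorem gegenbauerPoly_recurrence (ν : ℝ) (n : ℕ) :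
    ((n : ℝ[X]) + 2) * gegenbauerPoly ν (n + 2) =
      2 * ((n : ℝ[X]) + 1 + C ν) * X * gegenbauerPoly ν (n + 1)
        - ((n : ℝ[X]) + 2 * C ν) * gegenbauerPoly ν n := by
  have h : ((n : ℝ[X]) + 2) * C (1 / ((n : ℝ) + 2)) = 1 := by
    have : ((n : ℝ[X]) + 2) = C ((n : ℝ) + 2) := by simp [C_ofNat]
    rw [this, ← C_mul, mul_one_div_cancel (by positivity), C_1]
  rw [gegenbauerPoly, ← mul_assoc, h]
  simp only [map_mul, map_add, map_natCast, C_ofNat, map_one]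
  ring

theorem natDegree_gegenbauerPoly_le (ν : ℝ) (n : ℕ) : (gegenbauerPoly ν n).natDegree ≤ n := by
  induction n using Nat.twoStepInduction with
  | zero => simp [gegenbauerPoly]
  | one => exact (natDegree_C_mul_le _ _).trans natDegree_X_le
  | more n h0 h1 =>
    rw [gegenbauerPoly]
    refine (natDegree_C_mul_le _ _).trans ((natDegree_sub_le _ _).trans (max_le ?_ ?_))
    · rw [mul_assoc]
      refine (natDegree_C_mul_le _ _).trans (natDegree_mul_le.trans ?_)
      have := natDegree_X_le (R := ℝ)
      omega
    · exact (natDegree_C_mul_le _ _).trans (by omega)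

theorem derivative_gegenbauerPoly_aux (ν : ℝ) (n : ℕ) :
    derivative (gegenbauerPoly ν (n + 1)) =
        X * derivative (gegenbauerPoly ν n) + ((n : ℝ[X]) + 2 * C ν) * gegenbauerPoly ν n ∧
      X * derivative (gegenbauerPoly ν (n + 1)) =
        derivative (gegenbauerPoly ν n) + ((n : ℝ[X]) + 1) * gegenbauerPoly ν (n + 1) := by
  induction n with
  | zero =>
    simp [gegenbauerPoly, C_ofNat]
    ring
  | succ n ih =>
    obtain ⟨hA, hB⟩ := ih
    have hr := gegenbauerPoly_recurrence ν n
    have hd := congrArg derivative hr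
    simp only [derivative_mul, derivative_add, derivative_sub, derivative_natCast,
      derivative_ofNat, derivative_C, derivative_X, derivative_one] at hd
    have hne : ((n : ℝ[X]) + 2) ≠ 0 := by
      have : ((n : ℝ[X]) + 2) = ((n + 2 : ℕ) : ℝ[X]) := by push_cast; rfl
      rw [this]
      exact Nat.cast_ne_zero.mpr (by omega)
    have hA' : derivative (gegenbauerPoly ν (n + 2)) =
        X * derivative (gegenbauerPoly ν (n + 1))
          + ((n : ℝ[X]) + 1 + 2 * C ν) * gegenbauerPoly ν (n + 1) := by
      apply mul_left_cancel₀ hne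
      linear_combination hd + ((n : ℝ[X]) + 2 * C ν) * hB
    push_cast
    refine ⟨hA', ?_⟩
    linear_combination X * hA' - hA + X * hB - hr

/-- The Gegenbauer differential equation. -/
theorem gegenbauerPoly_ode (ν : ℝ) (n : ℕ) :
    (1 - X ^ 2) * derivative (derivative (gegenbauerPoly ν n))
      - (1 + 2 * C ν) * X * derivative (gegenbauerPoly ν n)
      + (n : ℝ[X]) * ((n : ℝ[X]) + 2 * C ν) * gegenbauerPoly ν n = 0 := by
  cases n with
  | zero => simp [gegenbauerPoly]
  | succ n =>
    obtain ⟨hA, hB⟩ := derivative_gegenbauerPoly_aux ν n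
    have hA' := congrArg derivative hA
    have hB' := congrArg derivative hB
    simp only [derivative_mul, derivative_add, derivative_natCast,
      derivative_ofNat, derivative_C, derivative_X, derivative_one] at hA' hB'
    push_cast
    linear_combination hA' - X * hB' - ((n : ℝ[X]) + 1 + 2 * C ν) * hB

theorem iterate_derivative_gegenbauerPoly_ode (ν : ℝ) (n m : ℕ) :
    (1 - X ^ 2) * derivative^[m + 2] (gegenbauerPoly ν n)
      - (1 + 2 * C ν + 2 * (m : ℝ[X])) * X * derivative^[m + 1] (gegenbauerPoly ν n)
      + ((n : ℝ[X]) * ((n : ℝ[X]) + 2 * C ν) - (m : ℝ[X]) * ((m : ℝ[X]) + 2 * C ν)) * derivative^[m] (gegenbauerPoly ν n)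
      = 0 := by
  induction m with
  | zero =>
    have h := gegenbauerPoly_ode ν n
    simp only [Function.iterate_succ_apply', Function.iterate_zero_apply]
    push_cast
    linear_combination h
  | succ m ih =>
    have h := congrArg derivative ih
    simp only [derivative_mul, derivative_add, derivative_sub, derivative_natCast, derivative_pow,
      derivative_ofNat, derivative_C, derivative_X, derivative_one, derivative_zero,
      ← Function.iterate_succ_apply' (⇑derivative)] at h
    push_cast at h ⊢
    simp only [map_ofNat] at h
    linear_combination h

theorem gegenbauer_five_halves_one (n : ℕ) :
    gegenbauer (5 / 2) n 1 = ((n : ℝ) + 1) * (n + 2) * (n + 3) * (n + 4) / 24 := by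
  induction n using Nat.twoStepInduction with
  | zero => norm_num [gegenbauer]
  | one => norm_num [gegenbauer]
  | more n h0 h1 =>
    simp only [gegenbauer, h0, h1]
    push_cast
    field_simp
    ring

/-- The `m`-th derivative of `C_n^{5/2}`, scaled by the positive constant `1 / C_n^{5/2}(1)`. -/
noncomputable def normDeriv (n m : ℕ) (x : ℝ) : ℝ :=
  (derivative^[m] (gegenbauerPoly (5 / 2) n)).eval x / gegenbauer (5 / 2) n 1

theorem normDeriv_zero_one (n : ℕ) : normDeriv n 0 1 = 1 := by
  have h : gegenbauer (5 / 2) n 1 ≠ 0 := by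
    rw [gegenbauer_five_halves_one]
    positivity
  rw [normDeriv, Function.iterate_zero_apply, eval_gegenbauerPoly, div_self h]

theorem hasDerivAt_normDeriv (n m : ℕ) (x : ℝ) :
    HasDerivAt (normDeriv n m) (normDeriv n (m + 1) x) x := by
  have h := ((derivative^[m] (gegenbauerPoly (5 / 2) n)).hasDerivAt x).div_const
    (gegenbauer (5 / 2) n 1)
  rwa [← Function.iterate_succ_apply' (⇑derivative)] at h

theorem normDeriv_ode (n m : ℕ) (x : ℝ) :
    (1 - x ^ 2) * normDeriv n (m + 2) x - (6 + 2 * m) * x * normDeriv n (m + 1) x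
      + ((n : ℝ) * (n + 5) - m * (m + 5)) * normDeriv n m x = 0 := by
  have h := congrArg (eval x) (iterate_derivative_gegenbauerPoly_ode (5 / 2) n m)
  simp only [eval_add, eval_sub, eval_mul, eval_one, eval_pow, eval_X, eval_C, eval_natCast,
    eval_ofNat, eval_zero] at h
  simp only [normDeriv]
  linear_combination h / gegenbauer (5 / 2) n 1

theorem normDeriv_eq_zero {n m : ℕ} (h : n < m) (x : ℝ) : normDeriv n m x = 0 := by
  rw [normDeriv, iterate_derivative_eq_zero ((natDegree_gegenbauerPoly_le _ _).trans_lt h),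
    eval_zero, zero_div]

theorem normDeriv_succ_one (n m : ℕ) :
    normDeriv n (m + 1) 1 =
      ((n : ℝ) * (n + 5) - m * (m + 5)) / (6 + 2 * m) * normDeriv n m 1 := by
  have h := normDeriv_ode n m 1
  field_simp
  linear_combination -h

theorem normDeriv_one_nonneg (n m : ℕ) : 0 ≤ normDeriv n m 1 := by
  induction m with
  | zero => simp [normDeriv_zero_one]
  | succ m ih =>
    rcases le_or_gt m n with h | h
    · have h' : (m : ℝ) ≤ n := by exact_mod_cast h
      have : (0 : ℝ) ≤ (n : ℝ) * (n + 5) - m * (m + 5) := by nlinarith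
      rw [normDeriv_succ_one]
      positivity
    · rw [normDeriv_eq_zero (by omega)]

/-- Sonin's function of the `m`-th derivative is increasing on `[0, ∞)`. -/
theorem sonin_normDeriv_le (n m : ℕ) {x y : ℝ} (hx : 0 ≤ x) (hxy : x ≤ y) :
    ((n : ℝ) * (n + 5) - m * (m + 5)) * normDeriv n m x ^ 2
        + (1 - x ^ 2) * normDeriv n (m + 1) x ^ 2 ≤
      ((n : ℝ) * (n + 5) - m * (m + 5)) * normDeriv n m y ^ 2
        + (1 - y ^ 2) * normDeriv n (m + 1) y ^ 2 := by
  set K : ℝ := (n : ℝ) * (n + 5) - m * (m + 5) with hK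
  have hd (t : ℝ) : HasDerivAt
      (fun t => K * normDeriv n m t ^ 2 + (1 - t ^ 2) * normDeriv n (m + 1) t ^ 2)
      ((10 + 4 * m) * t * normDeriv n (m + 1) t ^ 2) t := by
    have h0 := hasDerivAt_normDeriv n m t
    have h1 := hasDerivAt_normDeriv n (m + 1) t
    have ht := ((hasDerivAt_id t).pow 2).const_sub 1
    have h := ((h0.pow 2).const_mul K).add (ht.mul (h1.pow 2))
    refine h.congr_deriv ?_
    have ho := normDeriv_ode n m t
    simp only [Pi.pow_apply, id]
    push_cast
    linear_combination 2 * normDeriv n (m + 1) t * ho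
  have hmono : MonotoneOn
      (fun t => K * normDeriv n m t ^ 2 + (1 - t ^ 2) * normDeriv n (m + 1) t ^ 2)
      (Set.Ici 0) := by
    refine monotoneOn_of_deriv_nonneg (convex_Ici 0)
      (fun t _ => (hd t).continuousAt.continuousWithinAt)
      (fun t _ => (hd t).differentiableAt.differentiableWithinAt) (fun t ht => ?_)
    rw [interior_Ici, Set.mem_Ioi] at ht
    rw [(hd t).deriv]
    positivity
  exact hmono hx (hx.trans hxy) hxy

theorem abs_normDeriv_le (n m : ℕ) {x : ℝ} (hx : x ∈ Set.Icc (0 : ℝ) 1) :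
    |normDeriv n m x| ≤ normDeriv n m 1 := by
  rcases lt_or_ge m n with h | h
  · have h' : (m : ℝ) < n := by exact_mod_cast h
    have hK : (0 : ℝ) < (n : ℝ) * (n + 5) - m * (m + 5) := by
      have : (0 : ℝ) ≤ m := m.cast_nonneg
      nlinarith
    have hs := sonin_normDeriv_le n m hx.1 hx.2
    have hpos : 0 ≤ (1 - x ^ 2) * normDeriv n (m + 1) x ^ 2 :=
      mul_nonneg (by nlinarith [hx.1, hx.2]) (sq_nonneg _)
    refine abs_le_of_sq_le_sq (le_of_mul_le_mul_left ?_ hK) (normDeriv_one_nonneg n m)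
    linarith
  · have hc : normDeriv n m x = normDeriv n m 1 := by
      refine is_const_of_deriv_eq_zero (fun t => (hasDerivAt_normDeriv n m t).differentiableAt)
        (fun t => ?_) x 1
      rw [(hasDerivAt_normDeriv n m t).deriv, normDeriv_eq_zero (by omega)]
    rw [hc, abs_of_nonneg (normDeriv_one_nonneg n m)]

/-- Taylor expansion at `1`: the error is at most the first omitted term. -/
theorem abs_normDeriv_sub_taylor_le (n M m : ℕ) {z : ℝ} (hz : z ∈ Set.Icc (0 : ℝ) 1) :
    |normDeriv n m (1 - z)
        - ∑ j ∈ Finset.range M, (-1) ^ j * normDeriv n (m + j) 1 * z ^ j / j.factorial| ≤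
      normDeriv n (m + M) 1 * z ^ M / M.factorial := by
  induction M generalizing m z with
  | zero => simpa using abs_normDeriv_le n m ⟨by linarith [hz.2], by linarith [hz.1]⟩
  | succ M ih =>
    have hpow (c : ℝ) (j : ℕ) (t : ℝ) : HasDerivAt
        (fun t : ℝ => c * t ^ (j + 1) / (j + 1).factorial) (c * t ^ j / j.factorial) t := by
      refine (((hasDerivAt_pow (j + 1) t).const_mul c).div_const _).congr_deriv ?_
      rw [Nat.factorial_succ]
      push_cast
      have := j.factorial_pos
      field_simp
    have hf (t : ℝ) : HasDerivAt
        (fun t => normDeriv n m (1 - t) - ∑ j ∈ Finset.range (M + 1),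
          (-1) ^ j * normDeriv n (m + j) 1 * t ^ j / j.factorial)
        (-(normDeriv n (m + 1) (1 - t) - ∑ j ∈ Finset.range M,
          (-1) ^ j * normDeriv n (m + 1 + j) 1 * t ^ j / j.factorial)) t := by
      have h0 : HasDerivAt (fun t => normDeriv n m (1 - t)) (normDeriv n (m + 1) (1 - t) * -1) t :=
        (hasDerivAt_normDeriv n m (1 - t)).comp t ((hasDerivAt_id t).const_sub 1)
      have h1 : HasDerivAt (fun t => ∑ j ∈ Finset.range M,
          (-1) ^ (j + 1) * normDeriv n (m + (j + 1)) 1 * t ^ (j + 1) / (j + 1).factorial)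
          (∑ j ∈ Finset.range M,
            (-1) ^ (j + 1) * normDeriv n (m + (j + 1)) 1 * t ^ j / j.factorial) t :=
        HasDerivAt.fun_sum fun j _ => hpow _ j t
      simp only [Finset.sum_range_succ' _ M, pow_zero]
      refine (h0.sub (h1.add_const _)).congr_deriv ?_
      have : ∑ j ∈ Finset.range M,
            (-1) ^ (j + 1) * normDeriv n (m + (j + 1)) 1 * t ^ j / j.factorial =
          -∑ j ∈ Finset.range M,
            (-1) ^ j * normDeriv n (m + 1 + j) 1 * t ^ j / j.factorial := by
        rw [← Finset.sum_neg_distrib]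
        refine Finset.sum_congr rfl fun j _ => ?_
        rw [show m + (j + 1) = m + 1 + j by omega]
        ring
      rw [this]
      ring
    have h := image_norm_le_of_norm_deriv_right_le_deriv_boundary (a := 0) (b := 1)
      (B := fun t => normDeriv n (m + (M + 1)) 1 * t ^ (M + 1) / (M + 1).factorial)
      (fun t _ => (hf t).continuousAt.continuousWithinAt)
      (fun t _ => (hf t).hasDerivWithinAt) ?_ (fun t => hpow _ M t) ?_ hz
    · simpa only [Real.norm_eq_abs] using h
    · simp [Finset.sum_range_succ']
    · intro t ht
      rw [norm_neg, Real.norm_eq_abs]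
      simpa only [show m + 1 + M = m + (M + 1) by omega] using ih (m + 1) ⟨ht.1, ht.2.le⟩

/-- The ratio `normDeriv n (m + j) 1 * (18 * e) ^ j / normDeriv n m 1`, as a polynomial in
`e = 1 / (n * (n + 5))`. -/
noncomputable def taylorCoeff (e : ℝ) (m j : ℕ) : ℝ :=
  ∏ i ∈ Finset.range j, 9 * (1 - ((m : ℝ) + i) * (m + i + 5) * e) / (3 + (m + i))

theorem normDeriv_one_mul_pow {n : ℕ} {e : ℝ} (he : (n : ℝ) * (n + 5) * e = 1) (m j : ℕ) :
    normDeriv n (m + j) 1 * (18 * e) ^ j = normDeriv n m 1 * taylorCoeff e m j := by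
  induction j with
  | zero => simp [taylorCoeff]
  | succ j ih =>
    rw [taylorCoeff, Finset.prod_range_succ, ← taylorCoeff, ← mul_assoc, ← ih, ← add_assoc,
      normDeriv_succ_one, pow_succ]
    push_cast
    have h3 : (3 : ℝ) + (m + j) ≠ 0 := by positivity
    have h6 : (6 : ℝ) + 2 * (m + j) ≠ 0 := by positivity
    field_simp
    linear_combination 18 * (3 + ((m : ℝ) + j)) * normDeriv n (m + j) 1 * (18 * e) ^ j * he

theorem abs_normDeriv_sub_taylorCoeff_le {n : ℕ} {e : ℝ} (he : (n : ℝ) * (n + 5) * e = 1)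
    (he0 : 0 ≤ e) (he1 : e ≤ 1 / 66) (m M : ℕ) :
    |normDeriv n m (1 - 18 * e)
        - normDeriv n m 1 *
          ∑ j ∈ Finset.range M, (-1) ^ j * taylorCoeff e m j / j.factorial| ≤
      normDeriv n m 1 * (taylorCoeff e m M / M.factorial) := by
  have h := abs_normDeriv_sub_taylor_le n M m (z := 18 * e) ⟨by linarith, by linarith⟩
  rw [normDeriv_one_mul_pow he, mul_div_assoc] at h
  convert h using 3
  rw [Finset.mul_sum]
  refine Finset.sum_congr rfl fun j _ => ?_
  rw [mul_assoc ((-1) ^ j), normDeriv_one_mul_pow he]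
  ring

theorem normDeriv_nonneg_of_taylorCoeff {n : ℕ} {e : ℝ} (he : (n : ℝ) * (n + 5) * e = 1)
    (he0 : 0 ≤ e) (he1 : e ≤ 1 / 66) (m M : ℕ)
    (h : 0 ≤ ∑ j ∈ Finset.range M, (-1) ^ j * taylorCoeff e m j / j.factorial
      - taylorCoeff e m M / M.factorial) :
    0 ≤ normDeriv n m (1 - 18 * e) := by
  have ht := (abs_le.mp (abs_normDeriv_sub_taylorCoeff_le he he0 he1 m M)).1
  have := mul_nonneg (normDeriv_one_nonneg n m) h
  rw [mul_sub] at this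
  linarith

theorem normDeriv_le_of_nonneg {n m : ℕ} {a x y : ℝ}
    (h : ∀ t ∈ Set.Icc a 1, 0 ≤ normDeriv n (m + 1) t) (hx : a ≤ x) (hxy : x ≤ y) (hy : y ≤ 1) :
    normDeriv n m x ≤ normDeriv n m y := by
  have hmono : MonotoneOn (normDeriv n m) (Set.Icc a 1) := by
    refine monotoneOn_of_deriv_nonneg (convex_Icc a 1)
      (fun t _ => (hasDerivAt_normDeriv n m t).continuousAt.continuousWithinAt)
      (fun t _ => (hasDerivAt_normDeriv n m t).differentiableAt.differentiableWithinAt)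
      (fun t ht => ?_)
    rw [(hasDerivAt_normDeriv n m t).deriv]
    exact h t (interior_subset ht)
  exact hmono ⟨hx, hxy.trans hy⟩ ⟨hx.trans hxy, hy⟩ hxy

/-- The first derivative is nonnegative on `[1 - 18 e, 1]`, by descending induction on the order of
differentiation. -/
theorem normDeriv_one_nonneg_of_mem {n : ℕ} {e : ℝ} (he : (n : ℝ) * (n + 5) * e = 1)
    (he0 : 0 ≤ e) (he1 : e ≤ 1 / 66) : ∀ x ∈ Set.Icc (1 - 18 * e) 1, 0 ≤ normDeriv n 1 x := by
  have bernstein (i j : ℕ) : 0 ≤ e ^ i * (1 / 66 - e) ^ j :=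
    mul_nonneg (pow_nonneg he0 i) (pow_nonneg (by linarith) j)
  have step {m : ℕ} (M : ℕ) (h : ∀ x ∈ Set.Icc (1 - 18 * e) 1, 0 ≤ normDeriv n (m + 1) x)
      (ht : 0 ≤ ∑ j ∈ Finset.range M, (-1) ^ j * taylorCoeff e m j / j.factorial
        - taylorCoeff e m M / M.factorial) :
      ∀ x ∈ Set.Icc (1 - 18 * e) 1, 0 ≤ normDeriv n m x := fun x hx =>
    (normDeriv_nonneg_of_taylorCoeff he he0 he1 m M ht).trans
      (normDeriv_le_of_nonneg h le_rfl hx.1 hx.2)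
  have h6 : ∀ x ∈ Set.Icc (1 - 18 * e) 1, 0 ≤ normDeriv n 6 x := by
    intro x hx
    have hz : 1 - x ∈ Set.Icc (0 : ℝ) 1 := ⟨by linarith [hx.2], by linarith [hx.1]⟩
    have h := (abs_le.mp (abs_normDeriv_sub_taylor_le n 1 6 hz)).1
    have h7 := normDeriv_one_mul_pow he 6 1
    have hle : normDeriv n 7 1 * (1 - x) ≤ normDeriv n 7 1 * (18 * e) :=
      mul_le_mul_of_nonneg_left (by linarith [hx.1]) (normDeriv_one_nonneg n 7)
    simp [taylorCoeff] at h h7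
    have hp : 0 ≤ normDeriv n 6 1 * e := mul_nonneg (normDeriv_one_nonneg n 6) he0
    norm_num at h7
    linarith
  refine step 5 (step 5 (step 3 (step 3 (step 3 h6 ?_) ?_) ?_) ?_) ?_
  · norm_num [taylorCoeff, Finset.sum_range_succ, Finset.prod_range_succ, Nat.factorial]
    linarith [bernstein 0 3, bernstein 1 2, bernstein 2 1, bernstein 3 0]
  · norm_num [taylorCoeff, Finset.sum_range_succ, Finset.prod_range_succ, Nat.factorial]
    linarith [bernstein 0 3, bernstein 1 2, bernstein 2 1, bernstein 3 0]
  · norm_num [taylorCoeff, Finset.sum_range_succ, Finset.prod_range_succ, Nat.factorial]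
    linarith [bernstein 0 3, bernstein 1 2, bernstein 2 1, bernstein 3 0]
  · norm_num [taylorCoeff, Finset.sum_range_succ, Finset.prod_range_succ, Nat.factorial]
    linarith [bernstein 0 5, bernstein 1 4, bernstein 2 3, bernstein 3 2, bernstein 4 1,
      bernstein 5 0]
  · norm_num [taylorCoeff, Finset.sum_range_succ, Finset.prod_range_succ, Nat.factorial]
    linarith [bernstein 0 5, bernstein 1 4, bernstein 2 3, bernstein 3 2, bernstein 4 1,
      bernstein 5 0]

theorem abs_normDeriv_zero_le {n : ℕ} {e : ℝ} (he : (n : ℝ) * (n + 5) * e = 1)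
    (he0 : 0 ≤ e) (he1 : e ≤ 1 / 66) : |normDeriv n 0 (1 - 18 * e)| ≤ 0.075 := by
  have bernstein (i j : ℕ) : 0 ≤ e ^ i * (1 / 66 - e) ^ j :=
    mul_nonneg (pow_nonneg he0 i) (pow_nonneg (by linarith) j)
  have h := abs_le.mp (abs_normDeriv_sub_taylorCoeff_le he he0 he1 0 7)
  rw [normDeriv_zero_one] at h
  norm_num [taylorCoeff, Finset.sum_range_succ, Finset.prod_range_succ, Nat.factorial] at h
  rw [abs_le]
  constructor
  · linarith [h.1, bernstein 0 7, bernstein 1 6, bernstein 2 5, bernstein 3 4, bernstein 4 3,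
      bernstein 5 2, bernstein 6 1, bernstein 7 0]
  · linarith [h.2, bernstein 0 7, bernstein 1 6, bernstein 2 5, bernstein 3 4, bernstein 4 3,
      bernstein 5 2, bernstein 6 1, bernstein 7 0]

theorem normDeriv_one_le {n : ℕ} {e : ℝ} (he : (n : ℝ) * (n + 5) * e = 1)
    (he0 : 0 ≤ e) (he1 : e ≤ 1 / 66) :
    normDeriv n 1 (1 - 18 * e) ≤ (n : ℝ) * (n + 5) / 6 * 0.029 := by
  have bernstein (i j : ℕ) : 0 ≤ e ^ i * (1 / 66 - e) ^ j :=
    mul_nonneg (pow_nonneg he0 i) (pow_nonneg (by linarith) j)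
  have h := (abs_le.mp (abs_normDeriv_sub_taylorCoeff_le he he0 he1 1 6)).2
  have hp : ∑ j ∈ Finset.range 6, (-1) ^ j * taylorCoeff e 1 j / j.factorial
      + taylorCoeff e 1 6 / Nat.factorial 6 ≤ 0.029 := by
    norm_num [taylorCoeff, Finset.sum_range_succ, Finset.prod_range_succ, Nat.factorial]
    linarith [bernstein 0 6, bernstein 1 5, bernstein 2 4, bernstein 3 3, bernstein 4 2,
      bernstein 5 1, bernstein 6 0]
  have hb : normDeriv n 1 1 = (n : ℝ) * (n + 5) / 6 := by
    rw [normDeriv_succ_one, normDeriv_zero_one]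
    norm_num
  have hm := mul_le_mul_of_nonneg_left hp (normDeriv_one_nonneg n 1)
  rw [mul_add] at hm
  rw [← hb]
  linarith

theorem normDeriv_zero_ge {n : ℕ} (hn : 6 ≤ n) {x : ℝ} (hx : x ∈ Set.Icc (0 : ℝ) 1) :
    -0.081 ≤ normDeriv n 0 x := by
  have hn' : (6 : ℝ) ≤ n := by exact_mod_cast hn
  set N : ℝ := (n : ℝ) * (n + 5) with hN
  have hN66 : 66 ≤ N := by nlinarith
  have he : N * (1 / N) = 1 := mul_one_div_cancel (by positivity)
  have he0 : 0 ≤ 1 / N := by positivity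
  have he1 : 1 / N ≤ 1 / 66 := one_div_le_one_div_of_le (by norm_num) hN66
  set e : ℝ := 1 / N
  have hy := abs_normDeriv_zero_le he he0 he1
  rcases le_total (1 - 18 * e) x with h | h
  · have := normDeriv_le_of_nonneg (normDeriv_one_nonneg_of_mem he he0 he1) le_rfl h hx.2
    linarith [(abs_le.mp hy).1]
  · have hs := sonin_normDeriv_le n 0 hx.1 h
    have hd0 := normDeriv_one_nonneg_of_mem he he0 he1 (1 - 18 * e) ⟨le_rfl, by linarith⟩
    have hd1 := normDeriv_one_le he he0 he1
    rw [← hN] at hd1 hs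
    have hy2 : normDeriv n 0 (1 - 18 * e) ^ 2 ≤ 0.075 ^ 2 :=
      sq_le_sq' (abs_le.mp hy).1 (abs_le.mp hy).2
    have hd2 : normDeriv n 1 (1 - 18 * e) ^ 2 ≤ (N / 6 * 0.029) ^ 2 := pow_le_pow_left₀ hd0 hd1 2
    have hw : (1 - (1 - 18 * e) ^ 2) * normDeriv n 1 (1 - 18 * e) ^ 2 ≤
        36 * e * (N / 6 * 0.029) ^ 2 :=
      mul_le_mul (by nlinarith) hd2 (sq_nonneg _) (by positivity)
    have hw' : 36 * e * (N / 6 * 0.029) ^ 2 = N * 0.029 ^ 2 := by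
      linear_combination N * 0.029 ^ 2 * he
    have hpos : 0 ≤ (1 - x ^ 2) * normDeriv n 1 x ^ 2 :=
      mul_nonneg (by nlinarith [hx.1, hx.2]) (sq_nonneg _)
    have hN0 : 0 < N := by linarith
    have hsq : normDeriv n 0 x ^ 2 ≤ 0.081 ^ 2 := by
      refine le_of_mul_le_mul_left ?_ hN0
      have := mul_le_mul_of_nonneg_left hy2 hN0.le
      norm_num at hs this hw hw' ⊢
      linarith
    exact (abs_le.mp (abs_le_of_sq_le_sq hsq (by norm_num))).1

theorem gegenbauer_five_halves_five (x : ℝ) :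
    gegenbauer (5 / 2) 5 x = (9009 * x ^ 5 - 6930 * x ^ 3 + 945 * x) / 24 := by
  norm_num [gegenbauer]
  ring

theorem stmt_16 (k : ℕ) (hk : 6 ≤ k) (lam : ℝ) (hlam : lam = k * (k + 3))
    (x : ℝ) (hx : x ∈ Set.Icc (0:ℝ) 1) :
    -0.081 ≤ (24 / (lam * (lam + 2))) * gegenbauer (5/2) (k - 1) x := by
  obtain ⟨n, rfl⟩ : ∃ n, k = n + 1 := ⟨k - 1, by omega⟩
  rw [Nat.add_sub_cancel]
  rcases eq_or_lt_of_le hk with h | h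
  · obtain rfl : n = 5 := by omega
    rw [hlam, gegenbauer_five_halves_five]
    obtain ⟨h0, h1⟩ := hx
    norm_num
    nlinarith [mul_nonneg h0 (sq_nonneg (x - 0.6408)), mul_nonneg h0 (sq_nonneg (x * (x - 0.6408))),
      sq_nonneg (x - 0.6408), sq_nonneg (x * (x - 0.6408))]
  · have hge := normDeriv_zero_ge (n := n) (by omega) hx
    rw [normDeriv, Function.iterate_zero_apply, eval_gegenbauerPoly,
      gegenbauer_five_halves_one] at hge
    convert hge using 1
    rw [hlam]
    push_cast
    field_simp
    ring
end

section
/- Let k ≥ 6, λ_k = k(k+3), d = 10, b = 0.11, and F̃_k'(x) = (24/(λ_k(λ_k+2))) C_{k-1}^{5/2}(x). Then F̃_k'(x) ≤ b for 0 ≤ x ≤ 1 - d/λ_k, and F̃_k'(x) ≤ 1 - (λ_k/d)(1-b)(1-x) for 1 - d/λ_k ≤ x ≤ 1. -/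
/-- The coefficients of `₂F₁(m - n, m + n + 5; m + 3; u / 2)` as a power series in `-u`,
where `N = n * (n + 5)`. -/
noncomputable def hypCoeff (N : ℝ) (m j : ℕ) : ℝ :=
  ∏ i ∈ Finset.range j,
    (N - ((m : ℝ) + i) * (m + i + 5)) / (2 * ((m : ℝ) + i + 3) * ((i : ℝ) + 1))

/-- Partial sum of length `M` of the hypergeometric series with coefficients `hypCoeff N m`. -/
noncomputable def hypSum (N : ℝ) (m M : ℕ) (u : ℝ) : ℝ :=
  ∑ j ∈ Finset.range M, hypCoeff N m j * (-u) ^ j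

theorem hypCoeff_succ (N : ℝ) (m j : ℕ) :
    hypCoeff N m (j + 1) = hypCoeff N m j *
      ((N - ((m : ℝ) + j) * (m + j + 5)) / (2 * ((m : ℝ) + j + 3) * ((j : ℝ) + 1))) := by
  exact Finset.prod_range_succ _ _

theorem succ_mul_hypCoeff_succ (N : ℝ) (m j : ℕ) :
    ((j : ℝ) + 1) * hypCoeff N m (j + 1) =
      (N - m * (m + 5)) / (2 * ((m : ℝ) + 3)) * hypCoeff N (m + 1) j := by
  induction j with
  | zero => simp [hypCoeff]
  | succ j ih =>
    rw [hypCoeff_succ N m (j + 1), hypCoeff_succ N (m + 1) j]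
    rw [mul_left_comm, ← mul_assoc (_ / _ : ℝ), ← ih]
    push_cast
    field_simp
    ring

theorem hypCoeff_nonneg {n m : ℕ} (hm : m ≤ n) (j : ℕ) :
    0 ≤ hypCoeff (n * (n + 5)) m j := by
  by_cases h : m + j ≤ n
  · refine Finset.prod_nonneg fun i hi => ?_
    have hi' : m + i ≤ n := by
      have := Finset.mem_range.mp hi
      omega
    have hi'' : (m : ℝ) + i ≤ n := by exact_mod_cast hi'
    refine div_nonneg ?_ (by positivity)
    have : (0 : ℝ) ≤ m + i := by positivity
    nlinarith
  · refine (Finset.prod_eq_zero (i := n - m) (Finset.mem_range.mpr (by omega)) ?_).ge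
    rw [Nat.cast_sub hm]
    ring

theorem hypCoeff_eq_zero {n m j : ℕ} (hm : m ≤ n) (h : n < m + j) :
    hypCoeff (n * (n + 5)) m j = 0 := by
  refine Finset.prod_eq_zero (i := n - m) (Finset.mem_range.mpr (by omega)) ?_
  rw [Nat.cast_sub hm]
  ring

theorem hasDerivAt_hypSum (N : ℝ) (m M : ℕ) (u : ℝ) :
    HasDerivAt (hypSum N m (M + 1))
      (-((N - m * (m + 5)) / (2 * ((m : ℝ) + 3))) * hypSum N (m + 1) M u) u := by
  have h : ∀ j ∈ Finset.range (M + 1), HasDerivAt (fun u => hypCoeff N m j * (-u) ^ j)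
      (hypCoeff N m j * ((j : ℝ) * (-u) ^ (j - 1) * (-1))) u := fun j _ =>
    (((hasDerivAt_id u).neg).pow j).const_mul _
  have h' := HasDerivAt.fun_sum h
  refine h'.congr_deriv ?_
  rw [Finset.sum_range_succ', hypSum, Finset.mul_sum]
  simp only [Nat.cast_zero, zero_mul, mul_zero, add_zero]
  refine Finset.sum_congr rfl fun j _ => ?_
  have := succ_mul_hypCoeff_succ N m j
  push_cast
  linear_combination -(-u) ^ j * this

/-- The Gegenbauer differential equation, for truncated series. -/
theorem hypSum_ode_trunc (N u : ℝ) (M : ℕ) :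
    u * (2 - u) * ((N - 6) / 48) * hypSum N 2 M u - (1 - u) * hypSum N 1 (M + 1) u
      + hypSum N 0 (M + 2) u
      = ((M : ℝ) + 4) / 3 * hypCoeff N 1 (M + 1) * (-u) ^ (M + 1) := by
  induction M with
  | zero =>
    simp [hypSum, hypCoeff, Finset.sum_range_succ]
    ring
  | succ M ih =>
    have e0 : hypSum N 0 (M + 1 + 2) u
        = hypSum N 0 (M + 2) u + hypCoeff N 0 (M + 2) * (-u) ^ (M + 2) :=
      Finset.sum_range_succ _ _
    have e1 : hypSum N 1 (M + 1 + 1) u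
        = hypSum N 1 (M + 1) u + hypCoeff N 1 (M + 1) * (-u) ^ (M + 1) :=
      Finset.sum_range_succ _ _
    have e2 : hypSum N 2 (M + 1) u
        = hypSum N 2 M u + hypCoeff N 2 M * (-u) ^ M :=
      Finset.sum_range_succ _ _
    have r0 := succ_mul_hypCoeff_succ N 0 (M + 1)
    have r1 := succ_mul_hypCoeff_succ N 1 M
    have r2 := hypCoeff_succ N 1 (M + 1)
    have h1 : ((M : ℝ) + 1 + 1) ≠ 0 := by positivity
    rw [e0, e1, e2]
    push_cast at r0 r1 r2 ⊢
    have r0' : hypCoeff N 0 (M + 2) = N / 6 * hypCoeff N 1 (M + 1) / (M + 1 + 1) := by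
      rw [eq_div_iff h1]
      linear_combination r0
    have r1' : (N - 6) / 48 * hypCoeff N 2 M = (M + 1) * hypCoeff N 1 (M + 1) / 6 := by
      linear_combination -r1 / 6
    have key : hypCoeff N 0 (M + 2) - (M + 1) * hypCoeff N 1 (M + 1) / 6
        - hypCoeff N 1 (M + 1) = ((M : ℝ) + 5) / 3 * hypCoeff N 1 (M + 1 + 1) := by
      rw [r0', r2]
      field_simp
      ring
    linear_combination ih + u * (2 - u) * (-u) ^ M * r1' + (-u) ^ (M + 2) * key

theorem hypSum_ode {n M : ℕ} (hn : 1 ≤ n) (hM : n ≤ M + 1) (u : ℝ) :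
    u * (2 - u) * (((n : ℝ) * (n + 5) - 6) / 48) * hypSum (n * (n + 5)) 2 M u
      - (1 - u) * hypSum (n * (n + 5)) 1 (M + 1) u
      + hypSum (n * (n + 5)) 0 (M + 2) u = 0 := by
  rw [hypSum_ode_trunc, hypCoeff_eq_zero hn (by omega)]
  ring

theorem hypSum_zero {N : ℝ} {m M : ℕ} : hypSum N m (M + 1) 0 = 1 := by
  simp [hypSum, Finset.sum_range_succ', hypCoeff]

theorem cast_choose_succ_right (a b : ℕ) :
    (a.choose (b + 1) : ℝ) * (b + 1) = a.choose b * ((a : ℝ) - b) := by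
  rcases le_or_gt b a with h | h
  · have := Nat.choose_succ_right_eq a b
    rw [← Nat.cast_sub h]
    exact_mod_cast this
  · simp [Nat.choose_eq_zero_of_lt h, Nat.choose_eq_zero_of_lt (h.trans (Nat.lt_succ_self b))]

/-- The coefficient of `(-u) ^ j` in `C_n^{5/2} (1 - u)`. -/
noncomputable def gegenbauerCoeff (n j : ℕ) : ℝ :=
  (n + 4 + j).choose (2 * j + 4) * ∏ i ∈ Finset.range j, (2 * (i : ℝ) + 5) / (i + 1)

theorem gegenbauerCoeff_rec_zero (n : ℕ) :
    ((n : ℝ) + 2) * gegenbauerCoeff (n + 2) 0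
      = (2 * n + 7) * gegenbauerCoeff (n + 1) 0 - (n + 5) * gegenbauerCoeff n 0 := by
  simp only [gegenbauerCoeff, Finset.range_zero, Finset.prod_empty, mul_one, mul_zero,
    add_zero, zero_add]
  have a1 : ((n + 2 + 4).choose 4 : ℝ) = (n + 4).choose 4 + 2 * (n + 4).choose 3
      + (n + 4).choose 2 := by
    have : (n + 2 + 4).choose 4 = (n + 4).choose 4 + 2 * (n + 4).choose 3 + (n + 4).choose 2 := by
      simp only [show n + 2 + 4 = n + 4 + 1 + 1 by ring, Nat.choose_succ_succ' _ 3,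
        Nat.choose_succ_succ' _ 2]
      ring
    exact_mod_cast this
  have a2 : ((n + 1 + 4).choose 4 : ℝ) = (n + 4).choose 4 + (n + 4).choose 3 := by
    have : (n + 1 + 4).choose 4 = (n + 4).choose 4 + (n + 4).choose 3 := by
      simp only [show n + 1 + 4 = n + 4 + 1 by ring, Nat.choose_succ_succ' _ 3]
      ring
    exact_mod_cast this
  have c3 := cast_choose_succ_right (n + 4) 2
  push_cast at c3
  rw [a1, a2]
  linear_combination -c3

theorem gegenbauerCoeff_rec_succ (n j : ℕ) :
    ((n : ℝ) + 2) * gegenbauerCoeff (n + 2) (j + 1)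
      = (2 * n + 7) * (gegenbauerCoeff (n + 1) (j + 1) + gegenbauerCoeff (n + 1) j)
        - (n + 5) * gegenbauerCoeff n (j + 1) := by
  simp only [gegenbauerCoeff, Finset.prod_range_succ]
  have a1 : ((n + 2 + 4 + (j + 1)).choose (2 * (j + 1) + 4) : ℝ)
      = (n + 5 + j).choose (2 * j + 6) + 2 * (n + 5 + j).choose (2 * j + 5)
      + (n + 5 + j).choose (2 * j + 4) := by
    have : (n + 2 + 4 + (j + 1)).choose (2 * (j + 1) + 4)
      = (n + 5 + j).choose (2 * j + 6) + 2 * (n + 5 + j).choose (2 * j + 5)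
      + (n + 5 + j).choose (2 * j + 4) := by
      simp only [show n + 2 + 4 + (j + 1) = n + 5 + j + 1 + 1 by ring,
        show 2 * (j + 1) + 4 = 2 * j + 5 + 1 by ring, Nat.choose_succ_succ' _ (2 * j + 5),
        Nat.choose_succ_succ' _ (2 * j + 4)]
      ring
    exact_mod_cast this
  have a2 : ((n + 1 + 4 + (j + 1)).choose (2 * (j + 1) + 4) : ℝ)
      = (n + 5 + j).choose (2 * j + 6) + (n + 5 + j).choose (2 * j + 5) := by
    have : (n + 1 + 4 + (j + 1)).choose (2 * (j + 1) + 4)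
      = (n + 5 + j).choose (2 * j + 6) + (n + 5 + j).choose (2 * j + 5) := by
      simp only [show n + 1 + 4 + (j + 1) = n + 5 + j + 1 by ring,
        show 2 * (j + 1) + 4 = 2 * j + 5 + 1 by ring, Nat.choose_succ_succ' _ (2 * j + 5)]
      ring
    exact_mod_cast this
  have a3 : n + 4 + (j + 1) = n + 5 + j := by ring
  have a4 : n + 1 + 4 + j = n + 5 + j := by ring
  have a5 : 2 * (j + 1) + 4 = 2 * j + 6 := by ring
  rw [a1, a2, a3, a4, a5]
  have c5 := cast_choose_succ_right (n + 5 + j) (2 * j + 4)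
  push_cast at c5
  have hj : (j : ℝ) + 1 ≠ 0 := by positivity
  rw [show 2 * j + 4 + 1 = 2 * j + 5 by ring] at c5
  field_simp
  generalize (∏ i ∈ Finset.range j, (2 * (i : ℝ) + 5) / (i + 1)) = Q
  generalize ((n + 5 + j).choose (2 * j + 6) : ℝ) = z at *
  generalize ((n + 5 + j).choose (2 * j + 5) : ℝ) = y at *
  generalize ((n + 5 + j).choose (2 * j + 4) : ℝ) = x at *
  linear_combination -3 * c5

theorem gegenbauer_eq_sum_gegenbauerCoeff (n M : ℕ) (hM : n < M) (u : ℝ) :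
    gegenbauer (5 / 2) n (1 - u) = ∑ j ∈ Finset.range M, gegenbauerCoeff n j * (-u) ^ j := by
  induction n using Nat.strong_induction_on generalizing M with
  | _ n ih =>
  have hz : ∀ n j : ℕ, n < j → gegenbauerCoeff n j = 0 := fun n j h => by
    simp [gegenbauerCoeff, Nat.choose_eq_zero_of_lt (show n + 4 + j < 2 * j + 4 by omega)]
  match n, ih with
  | 0, _ =>
    rw [Finset.sum_eq_single 0 (fun j _ hj => by rw [hz 0 j (by omega), zero_mul])
      (fun h => absurd (Finset.mem_range.mpr hM) h)]
    simp [gegenbauer, gegenbauerCoeff]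
  | 1, _ =>
    obtain ⟨M, rfl⟩ : ∃ K, M = K + 2 := ⟨M - 2, by omega⟩
    rw [Finset.sum_range_succ', Finset.sum_range_succ', Finset.sum_eq_zero
      (fun j _ => by rw [hz 1 _ (by omega), zero_mul])]
    simp [gegenbauer, gegenbauerCoeff, Nat.choose]
    ring
  | n + 2, ih =>
    have h0 := ih n (by omega) M (by omega)
    obtain ⟨M, rfl⟩ : ∃ K, M = K + 1 := ⟨M - 1, by omega⟩
    have h1 := ih (n + 1) (by omega) (M + 1) (by omega)
    have h1' := ih (n + 1) (by omega) M (by omega)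
    have hn : (n : ℝ) + 2 ≠ 0 := by positivity
    have key : ∀ K : ℕ, ((n : ℝ) + 2) *
        ∑ j ∈ Finset.range (K + 1), gegenbauerCoeff (n + 2) j * (-u) ^ j
        = (2 * n + 7) * (∑ j ∈ Finset.range (K + 1), gegenbauerCoeff (n + 1) j * (-u) ^ j
          + (-u) * ∑ j ∈ Finset.range K, gegenbauerCoeff (n + 1) j * (-u) ^ j)
          - (n + 5) * ∑ j ∈ Finset.range (K + 1), gegenbauerCoeff n j * (-u) ^ j := by
      intro K
      induction K with
      | zero => simpa using gegenbauerCoeff_rec_zero n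
      | succ K ihK =>
        rw [Finset.sum_range_succ _ (K + 1), Finset.sum_range_succ _ (K + 1),
          Finset.sum_range_succ (fun j => gegenbauerCoeff n j * (-u) ^ j) (K + 1)]
        have e : ∑ j ∈ Finset.range (K + 1), gegenbauerCoeff (n + 1) j * (-u) ^ j
            = ∑ j ∈ Finset.range K, gegenbauerCoeff (n + 1) j * (-u) ^ j
              + gegenbauerCoeff (n + 1) K * (-u) ^ K := Finset.sum_range_succ _ _
        linear_combination ihK + (-u) ^ (K + 1) * gegenbauerCoeff_rec_succ n K
          + (2 * n + 7) * u * e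
    have := key M
    rw [← h0, ← h1, ← h1'] at this
    rw [gegenbauer, div_eq_iff hn]
    linear_combination -this

theorem gegenbauerCoeff_eq (n j : ℕ) :
    gegenbauerCoeff n j = (n + 4).choose 4 * hypCoeff (n * (n + 5)) 0 j := by
  induction j with
  | zero => simp [gegenbauerCoeff, hypCoeff]
  | succ j ih =>
    rw [hypCoeff_succ, ← mul_assoc, ← ih]
    simp only [gegenbauerCoeff, Finset.prod_range_succ]
    have a3 : n + 4 + (j + 1) = n + 4 + j + 1 := by ring
    have a5 : 2 * (j + 1) + 4 = 2 * j + 5 + 1 := by ring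
    rw [a3, a5, Nat.choose_succ_succ']
    have c5 := cast_choose_succ_right (n + 4 + j) (2 * j + 4)
    have c6 := cast_choose_succ_right (n + 4 + j) (2 * j + 5)
    push_cast at c5 c6 ⊢
    rw [show 2 * j + 4 + 1 = 2 * j + 5 by ring] at c5
    have hj : (j : ℝ) + 1 ≠ 0 := by positivity
    have hj5 : (2 * (j : ℝ) + 4 + 1) ≠ 0 := by positivity
    have hj6 : (2 * (j : ℝ) + 5 + 1) ≠ 0 := by positivity
    rw [← eq_div_iff hj5] at c5
    rw [← eq_div_iff hj6] at c6
    rw [c6, c5]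
    field_simp
    ring

theorem gegenbauer_eq_hypSum {n M : ℕ} (hM : n < M) (u : ℝ) :
    gegenbauer (5 / 2) n (1 - u) = (n + 4).choose 4 * hypSum (n * (n + 5)) 0 M u := by
  rw [gegenbauer_eq_sum_gegenbauerCoeff n M hM, hypSum, Finset.mul_sum]
  exact Finset.sum_congr rfl fun j _ => by rw [gegenbauerCoeff_eq, mul_assoc]

theorem alternating_sum_mem_Icc {t : ℕ → ℝ} (h0 : ∀ j, 0 ≤ t j) (h1 : ∀ j, t (j + 1) ≤ t j)
    (M : ℕ) : ∑ j ∈ Finset.range M, (-1) ^ j * t j ∈ Set.Icc 0 (t 0) := by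
  induction M generalizing t with
  | zero => simpa using h0 0
  | succ M ih =>
    obtain ⟨ha, hb⟩ := ih (t := fun j => t (j + 1)) (fun j => h0 _) (fun j => h1 _)
    have e : ∑ j ∈ Finset.range (M + 1), (-1) ^ j * t j
        = t 0 - ∑ j ∈ Finset.range M, (-1) ^ j * t (j + 1) := by
      rw [Finset.sum_range_succ', sub_eq_add_neg, ← Finset.sum_neg_distrib, add_comm]
      simp [pow_succ]
    rw [e]
    have := h1 0
    simp only [zero_add] at hb
    constructor <;> linarith

theorem hypSum_sub_mem_Icc {n m J : ℕ} (hm : m ≤ n) (hJ : 15 ≤ 2 * (m + J + 3) * (J + 1))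
    {u : ℝ} (hu : 0 ≤ u) (hu' : (n : ℝ) * (n + 5) * u ≤ 15) (L : ℕ) :
    (-1) ^ J * (hypSum (n * (n + 5)) m (J + L) u - hypSum (n * (n + 5)) m J u)
      ∈ Set.Icc 0 (hypCoeff (n * (n + 5)) m J * u ^ J) := by
  have h0 : ∀ j, 0 ≤ hypCoeff (n * (n + 5)) m (J + j) * u ^ (J + j) := fun j =>
    mul_nonneg (hypCoeff_nonneg hm _) (pow_nonneg hu _)
  have h1 : ∀ j, hypCoeff (n * (n + 5)) m (J + (j + 1)) * u ^ (J + (j + 1))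
      ≤ hypCoeff (n * (n + 5)) m (J + j) * u ^ (J + j) := fun j => by
    rw [← add_assoc, hypCoeff_succ, pow_succ]
    have hd : 0 < 2 * ((m : ℝ) + (J + j : ℕ) + 3) * ((J + j : ℕ) + 1) := by positivity
    have hr : ((n : ℝ) * (n + 5) - ((m : ℝ) + (J + j : ℕ)) * (m + (J + j : ℕ) + 5)) /
        (2 * ((m : ℝ) + (J + j : ℕ) + 3) * ((J + j : ℕ) + 1)) * u ≤ 1 := by
      rw [div_mul_eq_mul_div, div_le_one hd]
      have hJ' : (15 : ℝ) ≤ 2 * (m + J + 3) * (J + 1) := by exact_mod_cast hJ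
      have hmono : 2 * ((m : ℝ) + J + 3) * (J + 1)
          ≤ 2 * ((m : ℝ) + (J + j : ℕ) + 3) * ((J + j : ℕ) + 1) := by
        have : (J : ℝ) ≤ (J + j : ℕ) := by exact_mod_cast Nat.le_add_right J j
        gcongr
      have : 0 ≤ ((m : ℝ) + (J + j : ℕ)) * (m + (J + j : ℕ) + 5) * u := by positivity
      linarith
    calc _ = hypCoeff (n * (n + 5)) m (J + j) * u ^ (J + j) * (_ * u) := by ring
      _ ≤ _ := mul_le_of_le_one_right (h0 j) hr
  have := alternating_sum_mem_Icc h0 h1 L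
  suffices h : (-1) ^ J * (hypSum (n * (n + 5)) m (J + L) u - hypSum (n * (n + 5)) m J u)
      = ∑ j ∈ Finset.range L, (-1) ^ j * (hypCoeff (n * (n + 5)) m (J + j) * u ^ (J + j)) by
    rw [h]
    exact this
  rw [hypSum, hypSum, Finset.sum_range_add, add_sub_cancel_left, Finset.mul_sum]
  refine Finset.sum_congr rfl fun j _ => ?_
  rw [neg_pow u, pow_add (-1 : ℝ)]
  have : ((-1 : ℝ) ^ J) * (-1) ^ J = 1 := by rw [← mul_pow]; simp
  linear_combination (-1) ^ j * u ^ (J + j) * hypCoeff (n * (n + 5)) m (J + j) * this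

theorem hypSum_even_le {n m J M : ℕ} (hm : m ≤ n) (hJ : 15 ≤ 2 * (m + J + 3) * (J + 1))
    (he : Even J) (hM : J ≤ M) {u : ℝ} (hu : 0 ≤ u) (hu' : (n : ℝ) * (n + 5) * u ≤ 15) :
    hypSum (n * (n + 5)) m J u ≤ hypSum (n * (n + 5)) m M u := by
  have := (hypSum_sub_mem_Icc hm hJ hu hu' (M - J)).1
  rw [he.neg_one_pow, Nat.add_sub_cancel' hM] at this
  linarith

theorem le_hypSum_odd {n m J M : ℕ} (hm : m ≤ n) (hJ : 15 ≤ 2 * (m + J + 3) * (J + 1))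
    (ho : Odd J) (hM : J ≤ M) {u : ℝ} (hu : 0 ≤ u) (hu' : (n : ℝ) * (n + 5) * u ≤ 15) :
    hypSum (n * (n + 5)) m M u ≤ hypSum (n * (n + 5)) m J u := by
  have := (hypSum_sub_mem_Icc hm hJ hu hu' (M - J)).1
  rw [ho.neg_one_pow, Nat.add_sub_cancel' hM] at this
  linarith

theorem hypSum_six_nonneg {N : ℝ} (hN : 50 ≤ N) :
    0 ≤ hypSum N 1 6 (15 / N) ∧ 0 ≤ hypSum N 2 6 (15 / N) ∧
    0 ≤ hypSum N 3 6 (15 / N) ∧ 0 ≤ hypSum N 4 6 (15 / N) ∧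
    -0.07 ≤ hypSum N 0 6 (15 / N) := by
  obtain ⟨y, hy, rfl⟩ : ∃ y : ℝ, 0 ≤ y ∧ N = y + 50 := ⟨N - 50, by linarith, by ring⟩
  refine ⟨?_, ?_, ?_, ?_, ?_⟩
  all_goals
    simp only [hypSum, hypCoeff, Finset.sum_range_succ, Finset.prod_range_succ,
      Finset.range_zero, Finset.sum_empty, Finset.prod_empty]
    push_cast
    rw [← sub_nonneg]
    field_simp
    ring_nf
    positivity

theorem hypSum_seven_le {N : ℝ} (hN : 50 ≤ N) :
    hypSum N 0 7 (15 / N) ≤ 0.07 ∧ hypSum N 1 7 (15 / N) ≤ 0.08 ∧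
    hypSum N 0 7 (10 / (N + 4)) ≤ 0.11 := by
  obtain ⟨y, hy, rfl⟩ : ∃ y : ℝ, 0 ≤ y ∧ N = y + 50 := ⟨N - 50, by linarith, by ring⟩
  refine ⟨?_, ?_, ?_⟩
  all_goals
    simp only [hypSum, hypCoeff, Finset.sum_range_succ, Finset.prod_range_succ,
      Finset.range_zero, Finset.sum_empty, Finset.prod_empty]
    push_cast
    rw [← sub_nonneg]
    field_simp
    ring_nf
    positivity

theorem antitoneOn_hypSum {N : ℝ} {m M : ℕ} {s : Set ℝ} (hs : Convex ℝ s)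
    (hN : (m : ℝ) * (m + 5) ≤ N) (h : ∀ u ∈ s, 0 ≤ hypSum N (m + 1) M u) :
    AntitoneOn (hypSum N m (M + 1)) s := by
  refine antitoneOn_of_hasDerivWithinAt_nonpos hs
    (fun u _ => (hasDerivAt_hypSum N m M u).continuousAt.continuousWithinAt)
    (fun u _ => (hasDerivAt_hypSum N m M u).hasDerivWithinAt) fun u hu => ?_
  refine mul_nonpos_of_nonpos_of_nonneg (neg_nonpos.mpr ?_) (h u (interior_subset hu))
  exact div_nonneg (by linarith) (by positivity)

theorem hypSum_nonneg_of_succ {n m M : ℕ} (hm : m ≤ n) (hM : 6 ≤ M + 1) (hn : 1 ≤ n)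
    (h6 : 0 ≤ hypSum (n * (n + 5)) m 6 (15 / (n * (n + 5))))
    (h : ∀ u ∈ Set.Icc (0 : ℝ) (15 / (n * (n + 5))), 0 ≤ hypSum (n * (n + 5)) (m + 1) M u) :
    ∀ u ∈ Set.Icc (0 : ℝ) (15 / (n * (n + 5))), 0 ≤ hypSum (n * (n + 5)) m (M + 1) u := by
  intro u hu
  have hn' : (0 : ℝ) < n := by exact_mod_cast hn
  have hm' : (m : ℝ) ≤ n := by exact_mod_cast hm
  have hU : (0 : ℝ) ≤ 15 / (n * (n + 5)) := by positivity
  refine le_trans (h6.trans (hypSum_even_le hm (by nlinarith) (by decide) hM hU ?_))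
    (antitoneOn_hypSum (convex_Icc _ _) (by gcongr) h hu ⟨hU, le_rfl⟩ hu.2)
  rw [mul_div_cancel₀ _ (by positivity)]

/-- The Sonin function `G² + (1 - x²) G'² / N` of the normalized Gegenbauer polynomial. -/
theorem antitoneOn_sonin {n M : ℕ} (hn : 1 ≤ n) (hM : n ≤ M + 1) :
    AntitoneOn (fun u => hypSum (n * (n + 5)) 0 (M + 2) u ^ 2
      + u * (2 - u) * ((n : ℝ) * (n + 5) / 36) * hypSum (n * (n + 5)) 1 (M + 1) u ^ 2)
      (Set.Icc 0 1) := by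
  have hd : ∀ u : ℝ, HasDerivAt (fun u => hypSum (n * (n + 5)) 0 (M + 2) u ^ 2
      + u * (2 - u) * ((n : ℝ) * (n + 5) / 36) * hypSum (n * (n + 5)) 1 (M + 1) u ^ 2)
      (-(5 * ((n : ℝ) * (n + 5)) / 18) * (1 - u)
        * hypSum (n * (n + 5)) 1 (M + 1) u ^ 2) u := by
    intro u
    have d0 := hasDerivAt_hypSum (n * (n + 5)) 0 (M + 1) u
    have d1 := hasDerivAt_hypSum (n * (n + 5)) 1 M u
    have dw := (hasDerivAt_id' u).mul ((hasDerivAt_id' u).const_sub 2)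
    have d := (d0.pow 2).add ((dw.mul_const ((n : ℝ) * (n + 5) / 36)).mul (d1.pow 2))
    refine d.congr_deriv ?_
    have ode := hypSum_ode hn hM u
    push_cast
    simp only [Pi.mul_apply, Pi.pow_apply, zero_add, pow_one]
    linear_combination (-(n : ℝ) * (n + 5) / 3) * hypSum (n * (n + 5)) 1 (M + 1) u * ode
  refine antitoneOn_of_hasDerivWithinAt_nonpos (convex_Icc _ _)
    (fun u _ => (hd u).continuousAt.continuousWithinAt)
    (fun u _ => (hd u).hasDerivWithinAt) fun u hu => ?_
  have hu1 : 0 ≤ 1 - u := by linarith [(interior_subset hu).2]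
  have : 0 ≤ 5 * ((n : ℝ) * (n + 5)) / 18 * (1 - u) * hypSum (n * (n + 5)) 1 (M + 1) u ^ 2 := by
    positivity
  linarith

theorem convexOn_hypSum_zero {N : ℝ} {M : ℕ} {s : Set ℝ} (hs : Convex ℝ s) (hN : 6 ≤ N)
    (h : ∀ u ∈ s, 0 ≤ hypSum N 2 M u) : ConvexOn ℝ s (hypSum N 0 (M + 2)) := by
  have hd : deriv (hypSum N 0 (M + 2)) = fun u => -(N / 6) * hypSum N 1 (M + 1) u := by
    ext u
    rw [(hasDerivAt_hypSum N 0 (M + 1) u).deriv]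
    norm_num
  refine MonotoneOn.convexOn_of_deriv hs
    (fun u _ => (hasDerivAt_hypSum N 0 (M + 1) u).continuousAt.continuousWithinAt)
    (fun u _ => (hasDerivAt_hypSum N 0 (M + 1) u).differentiableAt.differentiableWithinAt) ?_
  rw [hd]
  intro a ha b hb hab
  have := antitoneOn_hypSum hs (by norm_num; linarith) h (interior_subset ha)
    (interior_subset hb) hab
  have hN' : 0 ≤ N / 6 := by linarith
  simp only [neg_mul, neg_le_neg_iff]
  gcongr

theorem cast_choose_four (n : ℕ) :
    24 * ((n + 4).choose 4 : ℝ) = (n + 1) * (n + 2) * (n + 3) * (n + 4) := by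
  have c1 := cast_choose_succ_right (n + 4) 0
  have c2 := cast_choose_succ_right (n + 4) 1
  have c3 := cast_choose_succ_right (n + 4) 2
  have c4 := cast_choose_succ_right (n + 4) 3
  push_cast [Nat.choose_zero_right] at c1 c2 c3 c4
  linear_combination 6 * c4 + 2 * (n + 1) * c3 + (n + 1) * (n + 2) * c2
    + (n + 1) * (n + 2) * (n + 3) * c1

theorem stmt_17 (k : ℕ) (hk : 6 ≤ k) (lam : ℝ) (hlam : lam = k * (k + 3)) :
    (∀ x : ℝ, 0 ≤ x → x ≤ 1 - 10 / lam →
      (24 / (lam * (lam + 2))) * gegenbauer (5/2) (k - 1) x ≤ 0.11) ∧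
    (∀ x : ℝ, 1 - 10 / lam ≤ x → x ≤ 1 →
      (24 / (lam * (lam + 2))) * gegenbauer (5/2) (k - 1) x
        ≤ 1 - (lam / 10) * (1 - 0.11) * (1 - x)) := by
  obtain ⟨n, rfl⟩ : ∃ n, k = n + 1 := ⟨k - 1, by omega⟩
  have hn : 5 ≤ n := by omega
  have hn' : (5 : ℝ) ≤ n := by exact_mod_cast hn
  have hlam' : lam = n * (n + 5) + 4 := by
    rw [hlam]
    push_cast
    ring
  have hF : ∀ x : ℝ, 24 / (lam * (lam + 2)) * gegenbauer (5 / 2) (n + 1 - 1) x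
      = hypSum (n * (n + 5)) 0 (n + 12) (1 - x) := by
    intro x
    have h := gegenbauer_eq_hypSum (show n < n + 12 by omega) (1 - x)
    rw [sub_sub_cancel] at h
    have hl : 0 < lam * (lam + 2) := by
      rw [hlam']
      positivity
    rw [Nat.add_sub_cancel, h, div_mul_eq_mul_div, div_eq_iff hl.ne', hlam', ← mul_assoc,
      cast_choose_four]
    ring
  have hN : 50 ≤ (n : ℝ) * (n + 5) := by nlinarith
  have hU1 : 15 / ((n : ℝ) * (n + 5)) ≤ 1 := by
    rw [div_le_one (by positivity)]
    linarith
  have hU0 : 0 ≤ 15 / ((n : ℝ) * (n + 5)) := by positivity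
  have hNU : (n : ℝ) * (n + 5) * (15 / (n * (n + 5))) ≤ 15 := by
    rw [mul_div_cancel₀ _ (by positivity)]
  have hv0 : 0 < 10 / lam := by
    rw [hlam']
    positivity
  have hvU : 10 / lam ≤ 15 / ((n : ℝ) * (n + 5)) := by
    rw [hlam', div_le_div_iff₀ (by positivity) (by positivity)]
    linarith
  obtain ⟨b1, b2, b3, b4, b0⟩ := hypSum_six_nonneg hN
  obtain ⟨c0, c1, cv⟩ := hypSum_seven_le hN
  have p5 : ∀ u ∈ Set.Icc (0 : ℝ) (15 / (n * (n + 5))),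
      0 ≤ hypSum (n * (n + 5)) 5 (n + 7) u := by
    intro u hu
    have hu' : (n : ℝ) * (n + 5) * u ≤ 15 :=
      (mul_le_mul_of_nonneg_left hu.2 (by positivity)).trans hNU
    have := hypSum_even_le (J := 0) (M := n + 7) hn (by norm_num) (by decide) (by omega) hu.1 hu'
    simpa [hypSum] using this
  have p4 := hypSum_nonneg_of_succ (by omega) (by omega) (by omega) b4 p5
  have p3 := hypSum_nonneg_of_succ (by omega) (by omega) (by omega) b3 p4
  have p2 := hypSum_nonneg_of_succ (by omega) (by omega) (by omega) b2 p3
  have p1 := hypSum_nonneg_of_succ (by omega) (by omega) (by omega) b1 p2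
  have anti := antitoneOn_hypSum (m := 0) (convex_Icc _ _) (by norm_num; positivity) p1
  have conv := convexOn_hypSum_zero (convex_Icc _ _) (by linarith) p2
  have hv : hypSum (n * (n + 5)) 0 (n + 12) (10 / lam) ≤ 0.11 := by
    refine (le_hypSum_odd (J := 7) (by omega) (by norm_num) (by decide) (by omega) hv0.le
      ((mul_le_mul_of_nonneg_left hvU (by positivity)).trans hNU)).trans ?_
    rw [hlam']
    exact cv
  simp only [hF]
  refine ⟨fun x hx0 hx1 => ?_, fun x hx0 hx1 => ?_⟩
  · rcases le_total (1 - x) (15 / ((n : ℝ) * (n + 5))) with hx | hx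
    · exact (anti ⟨hv0.le, hvU⟩ ⟨by linarith, hx⟩ (by linarith)).trans hv
    · have hS := antitoneOn_sonin (n := n) (M := n + 10) (by omega) (by omega)
        ⟨hU0, hU1⟩ ⟨by linarith, by linarith⟩ hx
      have g0 := b0.trans (hypSum_even_le (M := n + 12) (by omega) (by norm_num) (by decide)
        (by omega) hU0 hNU)
      have g0' := (le_hypSum_odd (M := n + 12) (by omega) (by norm_num) (by decide)
        (by omega) hU0 hNU).trans c0
      have g1 := (le_hypSum_odd (M := n + 11) (by omega) (by norm_num) (by decide)
        (by omega) hU0 hNU).trans c1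
      have g1' := p1 _ ⟨hU0, le_rfl⟩
      have hw : 15 / ((n : ℝ) * (n + 5)) * (2 - 15 / (n * (n + 5))) * (n * (n + 5) / 36)
          ≤ 5 / 6 := by
        have : 15 / ((n : ℝ) * (n + 5)) * (n * (n + 5)) = 15 := div_mul_cancel₀ _ (by positivity)
        nlinarith
      have s0 : hypSum (n * (n + 5)) 0 (n + 12) (15 / (n * (n + 5))) ^ 2 ≤ 0.07 ^ 2 :=
        sq_le_sq' g0 g0'
      have s1 : hypSum (n * (n + 5)) 1 (n + 11) (15 / (n * (n + 5))) ^ 2 ≤ 0.08 ^ 2 :=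
        pow_le_pow_left₀ g1' g1 2
      have s2 := mul_le_mul hw s1 (sq_nonneg _) (by norm_num)
      have s3 : 0 ≤ (1 - x) * (2 - (1 - x)) * ((n : ℝ) * (n + 5) / 36)
          * hypSum (n * (n + 5)) 1 (n + 11) (1 - x) ^ 2 := by
        have h1 : 0 ≤ 1 - x := by linarith
        have h2 : 0 ≤ 2 - (1 - x) := by linarith
        positivity
      refine abs_le_of_sq_le_sq' ?_ (by norm_num) |>.2
      norm_num at s0 s1 s2 hS ⊢
      linarith
  · have hl : 0 < lam := by
      rw [hlam']
      positivity
    have ht1 : lam / 10 * (1 - x) ≤ 1 := by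
      have h1 : lam / 10 * (10 / lam) = 1 := by field_simp
      have hx : 1 - x ≤ 10 / lam := by linarith
      exact (mul_le_mul_of_nonneg_left hx (by positivity)).trans_eq h1
    have ht0 : 0 ≤ lam / 10 * (1 - x) := mul_nonneg (by positivity) (by linarith)
    have := conv.2 (x := 0) (y := 10 / lam) ⟨le_rfl, hU0⟩ ⟨hv0.le, hvU⟩
      (sub_nonneg.mpr ht1) ht0 (by ring)
    simp only [smul_eq_mul, mul_zero, zero_add, hypSum_zero, mul_one] at this
    rw [show lam / 10 * (1 - x) * (10 / lam) = 1 - x by field_simp] at this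
    have h2 := mul_le_mul_of_nonneg_left hv ht0
    linarith
end
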